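/- Consider the regularized Lur'e system ẋ ∈ F(x) with F(x) := {Ax + Bu : u ∈ −ΨΨ(Cx)} and suppose Assumption 1 (sector condition) holds. Suppose moreover: (ii) there exist a diagonal Γ = diag(γ₁,…,γ_p) with positive entries, a symmetric positive definite P and η > 0 such that the block matrix M̄ := [[PA + AᵀP + ηIₙ, PB], [BᵀP, −2Z − ΓCB − (ΓCB)ᵀ]] is negative semidefinite; and (iii) there exists a diagonal matrix H = diag(h₁,…,h_p) with ΓCA = HC and, for each i, either hᵢ ≤ −1, or hᵢ ≤ 0 and Z = 0. Then the origin is globally asymptotically stable: there exists a class-KL function β such that every Krasovskii solution x : [0,T) → ℝⁿ satisfies |x(t)| ≤ β(|x(0)|, t) for all t ∈ [0,T). -/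

import Mathlib

open Matrix MeasureTheory Filter Set
open scoped ENNReal

noncomputable section

/-- Euclidean norm on `Fin m → ℝ`. -/
def euclNorm {m : ℕ} (x : Fin m → ℝ) : ℝ := Real.sqrt (∑ i, x i ^ 2)

/-- Krasovskii regularization of a scalar function `ψ` at `y`:
`Ψ(y) = ⋂_{δ>0} closure (convexHull (ψ '' [y-δ, y+δ]))`. -/
def kras (ψ : ℝ → ℝ) (y : ℝ) : Set ℝ :=
  ⋂ δ ∈ Set.Ioi (0 : ℝ), closure (convexHull ℝ (ψ '' Set.Icc (y - δ) (y + δ)))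

/-- Product (decentralized) Krasovskii regularization `ΨΨ(y) = Ψ₁(y₁) × ⋯ × Ψ_p(y_p)`. -/
def PsiSet {p : ℕ} (ψ : Fin p → ℝ → ℝ) (y : Fin p → ℝ) : Set (Fin p → ℝ) :=
  {w | ∀ i, w i ∈ kras (ψ i) (y i)}

/-- The regularized Lur'e set-valued dynamics `F(x) = {Ax + Bu : u ∈ -ΨΨ(Cx)}`. -/
def lureF {n p : ℕ} (A : Matrix (Fin n) (Fin n) ℝ) (B : Matrix (Fin n) (Fin p) ℝ)
    (C : Matrix (Fin p) (Fin n) ℝ) (ψ : Fin p → ℝ → ℝ) (x : Fin n → ℝ) :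
    Set (Fin n → ℝ) :=
  {f | ∃ u : Fin p → ℝ, (fun i => -u i) ∈ PsiSet ψ (C.mulVec x) ∧
        f = A.mulVec x + B.mulVec u}

/-- Piecewise continuity: finitely many discontinuity points on every compact
interval, and finite one-sided limits at every point. -/
def PiecewiseContinuous (f : ℝ → ℝ) : Prop :=
  (∀ a b : ℝ, {s ∈ Set.Icc a b | ¬ ContinuousAt f s}.Finite) ∧
  (∀ x : ℝ, (∃ L : ℝ, Tendsto f (nhdsWithin x (Set.Ioi x)) (nhds L)) ∧
    (∃ L : ℝ, Tendsto f (nhdsWithin x (Set.Iio x)) (nhds L)))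

/-- Sector condition: there is `ζ = 1/z ∈ (0, +∞]` (with `z = ζ⁻¹ ≥ 0`, `z = 0`
corresponding to `ζ = +∞`) such that `ψ(s)(ψ(s) - ζ s) ≤ 0` for all `s`. -/
def Sector (ψ : ℝ → ℝ) (z : ℝ) : Prop :=
  (z = 0 ∧ ∀ s : ℝ, 0 ≤ s * ψ s) ∨
  (0 < z ∧ ∀ s : ℝ, ψ s * (ψ s - (1 / z) * s) ≤ 0)

/-- Class `KL` functions. -/
def ClassKL (β : ℝ → ℝ → ℝ) : Prop :=
  (∀ t : ℝ, 0 ≤ t → ContinuousOn (fun s => β s t) (Set.Ici 0) ∧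
    StrictMonoOn (fun s => β s t) (Set.Ici 0) ∧ β 0 t = 0) ∧
  (∀ s : ℝ, 0 ≤ s → AntitoneOn (fun t => β s t) (Set.Ici 0) ∧
    Tendsto (fun t => β s t) atTop (nhds 0))

/-- Class `K∞` functions. -/
def ClassKInf (α : ℝ → ℝ) : Prop :=
  ContinuousOn α (Set.Ici 0) ∧ StrictMonoOn α (Set.Ici 0) ∧ α 0 = 0 ∧
  Tendsto α atTop atTop

/-- A Krasovskii solution of `ẋ ∈ F(x)` on a time set `s` (a locally absolutely
continuous function whose derivative belongs to `F(x(t))` almost everywhere),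
formalized through the integral representation `x(t) = x(0) + ∫₀ᵗ f(τ) dτ`
with `f(τ) ∈ F(x(τ))` for a.e. `τ ∈ s`. -/
def IsKrasovskiiSolutionOn {n : ℕ} (F : (Fin n → ℝ) → Set (Fin n → ℝ))
    (x : ℝ → Fin n → ℝ) (s : Set ℝ) : Prop :=
  ∃ f : ℝ → Fin n → ℝ,
    (∀ t ∈ s, IntervalIntegrable f volume 0 t) ∧
    (∀ᵐ t ∂volume, t ∈ s → f t ∈ F (x t)) ∧
    ∀ t ∈ s, x t = x 0 + ∫ τ in (0:ℝ)..t, f τ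

/-- The time interval `[0, T)` with `T ∈ (0, +∞]`. -/
def timeItv (T : ℝ≥0∞) : Set ℝ := {t : ℝ | 0 ≤ t ∧ ENNReal.ofReal t < T}

/-- Global asymptotic stability of the origin: a class-`KL` bound holds along
every Krasovskii solution on every time interval `[0, T)`. -/
def GASOrigin {n p : ℕ} (A : Matrix (Fin n) (Fin n) ℝ) (B : Matrix (Fin n) (Fin p) ℝ)
    (C : Matrix (Fin p) (Fin n) ℝ) (ψ : Fin p → ℝ → ℝ) : Prop :=
  ∃ β : ℝ → ℝ → ℝ, ClassKL β ∧
    ∀ T : ℝ≥0∞, ∀ x : ℝ → Fin n → ℝ,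
      IsKrasovskiiSolutionOn (lureF A B C ψ) x (timeItv T) →
      ∀ t ∈ timeItv T, euclNorm (x t) ≤ β (euclNorm (x 0)) t

open Topology

lemma PiecewiseContinuous.countable_discontinuities {f : ℝ → ℝ} (hf : PiecewiseContinuous f) :
    {s | ¬ ContinuousAt f s}.Countable := by
  have hsub : {s | ¬ ContinuousAt f s} ⊆
      ⋃ k : ℕ, {s ∈ Set.Icc (-(k : ℝ)) k | ¬ ContinuousAt f s} := by
    intro s hs
    obtain ⟨k, hk⟩ := exists_nat_ge |s|
    exact mem_iUnion.2 ⟨k, abs_le.1 hk, hs⟩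
  exact (countable_iUnion fun k => (hf.1 _ _).countable).mono hsub

lemma PiecewiseContinuous.exists_bound_nhds {f : ℝ → ℝ} (hf : PiecewiseContinuous f) (x : ℝ) :
    ∃ M, ∀ᶠ s in 𝓝 x, |f s| ≤ M := by
  obtain ⟨⟨L₁, h₁⟩, ⟨L₂, h₂⟩⟩ := hf.2 x
  have e₁ := h₁.abs.eventually (eventually_le_nhds (lt_add_one |L₁|))
  have e₂ := h₂.abs.eventually (eventually_le_nhds (lt_add_one |L₂|))
  refine ⟨max |f x| (max (|L₁| + 1) (|L₂| + 1)), ?_⟩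
  rw [eventually_nhdsWithin_iff] at e₁ e₂
  filter_upwards [e₁, e₂] with s hs₁ hs₂
  rcases lt_trichotomy s x with h | rfl | h
  · exact (hs₂ h).trans ((le_max_right _ _).trans (le_max_right _ _))
  · exact le_max_left _ _
  · exact (hs₁ h).trans ((le_max_left _ _).trans (le_max_right _ _))

lemma PiecewiseContinuous.exists_bound {f : ℝ → ℝ} (hf : PiecewiseContinuous f) {K : Set ℝ}
    (hK : IsCompact K) : ∃ M, ∀ s ∈ K, |f s| ≤ M := by
  refine hK.induction_on (p := fun S => ∃ M, ∀ s ∈ S, |f s| ≤ M) ⟨0, by simp⟩ ?_ ?_ ?_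
  · rintro s t hst ⟨M, hM⟩
    exact ⟨M, fun x hx => hM x (hst hx)⟩
  · rintro s t ⟨M, hM⟩ ⟨N, hN⟩
    refine ⟨max M N, fun x hx => ?_⟩
    rcases hx with hx | hx
    · exact (hM x hx).trans (le_max_left _ _)
    · exact (hN x hx).trans (le_max_right _ _)
  · intro x _
    obtain ⟨M, hM⟩ := hf.exists_bound_nhds x
    exact ⟨_, mem_nhdsWithin_of_mem_nhds hM, M, fun s hs => hs⟩

lemma PiecewiseContinuous.aestronglyMeasurable {f : ℝ → ℝ} (hf : PiecewiseContinuous f) :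
    AEStronglyMeasurable f volume := by
  have hD := hf.countable_discontinuities
  have hcont : ContinuousOn f {s | ¬ ContinuousAt f s}ᶜ := fun s hs =>
    (not_not.1 hs : ContinuousAt f s).continuousWithinAt
  have := hcont.aestronglyMeasurable (μ := volume) hD.measurableSet.compl
  rwa [Measure.restrict_eq_self_of_ae_mem] at this
  exact hD.ae_notMem volume

lemma PiecewiseContinuous.intervalIntegrable {f : ℝ → ℝ} (hf : PiecewiseContinuous f) (a b : ℝ) :
    IntervalIntegrable f volume a b := by
  obtain ⟨M, hM⟩ := hf.exists_bound (isCompact_uIcc (a := a) (b := b))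
  rw [intervalIntegrable_iff]
  refine Measure.integrableOn_of_bounded (M := M) (by simp) hf.aestronglyMeasurable ?_
  exact (ae_restrict_iff' measurableSet_uIoc).2
    (Eventually.of_forall fun s hs => hM s (uIoc_subset_uIcc hs))

lemma PiecewiseContinuous.lipschitzOnWith_integral {f : ℝ → ℝ} (hf : PiecewiseContinuous f)
    (a b : ℝ) : ∃ K, LipschitzOnWith K (fun y => ∫ s in (0 : ℝ)..y, f s) (Set.Icc a b) := by
  obtain ⟨M, hM⟩ := hf.exists_bound (isCompact_Icc (a := a) (b := b))
  refine ⟨Real.toNNReal M, LipschitzOnWith.of_dist_le_mul fun x hx y hy => ?_⟩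
  rw [Real.dist_eq, Real.dist_eq, intervalIntegral.integral_interval_sub_left
    (hf.intervalIntegrable _ _) (hf.intervalIntegrable _ _), ← Real.norm_eq_abs]
  refine (intervalIntegral.norm_integral_le_of_norm_le_const (C := M) fun s hs => ?_).trans ?_
  · exact hM s ((uIcc_subset_Icc hy hx) (uIoc_subset_uIcc hs))
  · gcongr
    exact Real.le_coe_toNNReal M

lemma PiecewiseContinuous.continuous_integral {f : ℝ → ℝ} (hf : PiecewiseContinuous f) :
    Continuous (fun y => ∫ s in (0 : ℝ)..y, f s) :=
  intervalIntegral.continuous_primitive hf.intervalIntegrable 0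

/-- The sign condition implied by the sector condition. -/
lemma Sector.mul_nonneg {ψ : ℝ → ℝ} {z : ℝ} (h : Sector ψ z) (s : ℝ) : 0 ≤ s * ψ s := by
  rcases h with ⟨_, h⟩ | ⟨hz, h⟩
  · exact h s
  · have h1 : ψ s ^ 2 ≤ 1 / z * (s * ψ s) := by linarith [h s]
    have hz' : 0 < 1 / z := by positivity
    by_contra! hneg
    nlinarith [sq_nonneg (ψ s), mul_neg_of_pos_of_neg hz' hneg]

lemma Sector.mul_sq_le {ψ : ℝ → ℝ} {z : ℝ} (h : Sector ψ z) (s : ℝ) :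
    z * ψ s ^ 2 ≤ s * ψ s := by
  rcases h with ⟨rfl, h⟩ | ⟨hz, h⟩
  · simpa using h s
  · have h1 : ψ s ^ 2 ≤ 1 / z * (s * ψ s) := by linarith [h s]
    have h2 := mul_le_mul_of_nonneg_left h1 hz.le
    rwa [← mul_assoc, mul_one_div_cancel hz.ne', one_mul] at h2

lemma Sector.nonneg {ψ : ℝ → ℝ} {z : ℝ} (h : Sector ψ z) : 0 ≤ z := by
  rcases h with ⟨rfl, _⟩ | ⟨hz, _⟩
  exacts [le_rfl, hz.le]

lemma kras_subset_of_mapsTo {ψ : ℝ → ℝ} {y δ : ℝ} (hδ : 0 < δ) {S : Set ℝ} (hS : IsClosed S)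
    (hS' : Convex ℝ S) (h : MapsTo ψ (Set.Icc (y - δ) (y + δ)) S) : kras ψ y ⊆ S := by
  intro w hw
  have hw' : w ∈ closure (convexHull ℝ (ψ '' Set.Icc (y - δ) (y + δ))) := by
    simp only [kras, mem_iInter] at hw
    exact hw δ hδ
  exact closure_minimal (convexHull_min h.image_subset hS') hS hw'

lemma eq_of_mem_kras_of_continuousAt {ψ : ℝ → ℝ} {y w : ℝ} (hc : ContinuousAt ψ y)
    (hw : w ∈ kras ψ y) : w = ψ y := by
  refine eq_of_forall_dist_le fun ε hε => ?_
  obtain ⟨δ, hδ, h⟩ := Metric.continuousAt_iff.1 hc ε hε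
  refine kras_subset_of_mapsTo (half_pos hδ) Metric.isClosed_closedBall
    (convex_closedBall (ψ y) ε) (fun s hs => ?_) hw
  refine (h ?_).le
  rw [Real.dist_eq, abs_lt]
  constructor <;> linarith [hs.1, hs.2]

lemma Sector.neg {ψ : ℝ → ℝ} {z : ℝ} (h : Sector ψ z) : Sector (fun s => -ψ (-s)) z := by
  rcases h with ⟨rfl, h⟩ | ⟨hz, h⟩
  · exact Or.inl ⟨rfl, fun s => by linarith [h (-s)]⟩
  · exact Or.inr ⟨hz, fun s => by linarith [h (-s)]⟩

lemma Sector.mul_le_max {ψ : ℝ → ℝ} {z : ℝ} (h : Sector ψ z) (s : ℝ) : z * ψ s ≤ max s 0 := by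
  have h₁ := h.mul_nonneg s
  have h₂ := h.mul_sq_le s
  have hz := h.nonneg
  rcases le_or_gt (ψ s) 0 with hψ | hψ
  · exact (mul_nonpos_of_nonneg_of_nonpos hz hψ).trans (le_max_right _ _)
  · refine le_trans ?_ (le_max_left _ _)
    nlinarith

lemma Sector.min_le_mul {ψ : ℝ → ℝ} {z : ℝ} (h : Sector ψ z) (s : ℝ) : min s 0 ≤ z * ψ s := by
  have := h.neg.mul_le_max (-s)
  simp only [neg_neg] at this
  have h2 : max (-s) 0 = -min s 0 := by rw [← neg_zero, max_neg_neg, neg_zero]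
  linarith

lemma Sector.bounds_of_mem_kras {ψ : ℝ → ℝ} {z y w : ℝ} (h : Sector ψ z) (hw : w ∈ kras ψ y) :
    min y 0 ≤ z * w ∧ z * w ≤ max y 0 := by
  have key : ∀ ε > 0, min (y - ε) 0 ≤ z * w ∧ z * w ≤ max (y + ε) 0 := by
    intro ε hε
    refine kras_subset_of_mapsTo (S := {w | min (y - ε) 0 ≤ z * w ∧ z * w ≤ max (y + ε) 0})
      hε ?_ ?_ (fun s hs => ?_) hw
    · exact isClosed_Icc.preimage (continuous_const_mul z)
    · exact (convex_Icc (min (y - ε) 0) (max (y + ε) 0)).is_linear_preimage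
        (IsLinearMap.isLinearMap_smul z)
    · exact ⟨(min_le_min_right 0 hs.1).trans (h.min_le_mul s),
        (h.mul_le_max s).trans (max_le_max_right 0 hs.2)⟩
  constructor
  · refine le_of_forall_pos_le_add fun ε hε => ?_
    have := (key ε hε).1
    have h2 : min y 0 ≤ min (y - ε) 0 + ε := by
      rw [min_add]
      exact min_le_min (by linarith) (by linarith)
    linarith
  · refine le_of_forall_pos_le_add fun ε hε => ?_
    have := (key ε hε).2
    have h2 : max (y + ε) 0 ≤ max y 0 + ε := by
      rw [max_add]
      exact max_le_max (by linarith) (by linarith)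
    linarith

lemma Sector.mul_nonneg_of_mem_kras {ψ : ℝ → ℝ} {z y w : ℝ} (h : Sector ψ z)
    (hw : w ∈ kras ψ y) : 0 ≤ y * w := by
  rcases lt_trichotomy y 0 with hy | rfl | hy
  · refine mul_nonneg_of_nonpos_of_nonpos hy.le ?_
    refine kras_subset_of_mapsTo (δ := -y / 2) (by linarith) isClosed_Iic (convex_Iic 0)
      (fun s hs => ?_) hw
    have hs' : s < 0 := by linarith [hs.2]
    exact nonpos_of_mul_nonneg_right (h.mul_nonneg s) hs'
  · simp
  · refine _root_.mul_nonneg hy.le ?_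
    refine kras_subset_of_mapsTo (δ := y / 2) (by linarith) isClosed_Ici (convex_Ici 0)
      (fun s hs => ?_) hw
    have hs' : 0 < s := by linarith [hs.1]
    exact nonneg_of_mul_nonneg_right (h.mul_nonneg s) hs'

/-- The sector condition is inherited by the Krasovskii regularization. -/
lemma Sector.mul_sq_le_of_mem_kras {ψ : ℝ → ℝ} {z y w : ℝ} (h : Sector ψ z)
    (hw : w ∈ kras ψ y) : z * w ^ 2 ≤ y * w := by
  obtain ⟨h₁, h₂⟩ := h.bounds_of_mem_kras hw
  have h₃ := h.mul_nonneg_of_mem_kras hw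
  rcases lt_trichotomy y 0 with hy | rfl | hy
  · rw [min_eq_left hy.le] at h₁
    have hw0 : w ≤ 0 := nonpos_of_mul_nonneg_right h₃ hy
    nlinarith
  · have : z * w = 0 := le_antisymm (by simpa using h₂) (by simpa using h₁)
    rw [sq, ← mul_assoc, this, zero_mul]
  · rw [max_eq_left hy.le] at h₂
    have hw0 : 0 ≤ w := nonneg_of_mul_nonneg_right h₃ hy
    nlinarith

lemma Sector.monotoneOn_integral {ψ : ℝ → ℝ} {z : ℝ} (h : Sector ψ z)
    (hψ : PiecewiseContinuous ψ) :
    MonotoneOn (fun y => ∫ s in (0 : ℝ)..y, ψ s) (Set.Ici 0) := by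
  intro a ha b _ hab
  have hsub := intervalIntegral.integral_interval_sub_left
    (hψ.intervalIntegrable 0 b) (hψ.intervalIntegrable 0 a)
  have hab' : 0 ≤ ∫ s in a..b, ψ s := by
    rw [intervalIntegral.integral_of_le hab]
    refine setIntegral_nonneg measurableSet_Ioc fun s hs => ?_
    have hs' : 0 < s := lt_of_le_of_lt ha hs.1
    exact nonneg_of_mul_nonneg_right (h.mul_nonneg s) hs'
  linarith

lemma Sector.antitoneOn_integral {ψ : ℝ → ℝ} {z : ℝ} (h : Sector ψ z)
    (hψ : PiecewiseContinuous ψ) :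
    AntitoneOn (fun y => ∫ s in (0 : ℝ)..y, ψ s) (Set.Iic 0) := by
  intro a _ b hb hab
  have hsub := intervalIntegral.integral_interval_sub_left
    (hψ.intervalIntegrable 0 b) (hψ.intervalIntegrable 0 a)
  have hab' : ∫ s in a..b, ψ s ≤ 0 := by
    rw [intervalIntegral.integral_of_le hab, integral_Ioc_eq_integral_Ioo]
    refine setIntegral_nonpos measurableSet_Ioo fun s hs => ?_
    have hs' : s < 0 := lt_of_lt_of_le hs.2 hb
    exact nonpos_of_mul_nonneg_right (h.mul_nonneg s) hs'
  linarith

lemma Sector.integral_nonneg {ψ : ℝ → ℝ} {z : ℝ} (h : Sector ψ z)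
    (hψ : PiecewiseContinuous ψ) (y : ℝ) : 0 ≤ ∫ s in (0 : ℝ)..y, ψ s := by
  rcases le_total 0 y with hy | hy
  · simpa using h.monotoneOn_integral hψ (mem_Ici.2 le_rfl) hy hy
  · simpa using h.antitoneOn_integral hψ hy (mem_Iic.2 le_rfl) hy

/-- A differentiable function has zero derivative at almost every point that it maps into a
countable set. -/
lemma ae_deriv_eq_zero_of_mem_countable (y : ℝ → ℝ) {D : Set ℝ} (hD : D.Countable) :
    ∀ᵐ t, y t ∈ D → ∀ c, HasDerivAt y c t → c = 0 := by
  have hcount : ∀ d, {t | y t = d ∧ ∃ c, HasDerivAt y c t ∧ c ≠ 0}.Countable := by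
    intro d
    refine (HereditarilyLindelofSpace.isLindelof _).countable_of_isDiscrete
      (isDiscrete_iff_nhdsNE.2 ?_)
    rintro t ⟨ht, c, hc, hc0⟩
    rw [inf_principal_eq_bot]
    filter_upwards [hc.eventually_ne (c := d) hc0] with s hs hs'
    exact hs hs'.1
  have := (hD.biUnion fun d _ => hcount d).ae_notMem volume
  filter_upwards [this] with t ht hyt c hc
  by_contra hc0
  exact ht (mem_biUnion hyt ⟨rfl, c, hc, hc0⟩)

/-- Chain rule for the primitive of a piecewise continuous function along a curve. -/
lemma PiecewiseContinuous.hasDerivAt_integral_comp {ψ : ℝ → ℝ} (hψ : PiecewiseContinuous ψ)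
    {y : ℝ → ℝ} {t c w : ℝ} (hy : HasDerivAt y c t) (hw : w ∈ kras ψ (y t))
    (hc : ¬ ContinuousAt ψ (y t) → c = 0) :
    HasDerivAt (fun τ => ∫ s in (0 : ℝ)..y τ, ψ s) (w * c) t := by
  by_cases hcont : ContinuousAt ψ (y t)
  · rw [eq_of_mem_kras_of_continuousAt hcont hw]
    exact (intervalIntegral.integral_hasDerivAt_right (hψ.intervalIntegrable _ _)
      hψ.aestronglyMeasurable.stronglyMeasurableAtFilter hcont).comp t hy
  · obtain rfl := hc hcont
    rw [mul_zero]
    obtain ⟨K, hK⟩ := hψ.lipschitzOnWith_integral (y t - 1) (y t + 1)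
    have hcy := hy.continuousAt
    rw [hasDerivAt_iff_isLittleO] at hy ⊢
    simp only [smul_zero, sub_zero] at hy ⊢
    have hnear : ∀ᶠ τ in 𝓝 t, y τ ∈ Set.Icc (y t - 1) (y t + 1) :=
      hcy.eventually (Icc_mem_nhds (by linarith) (by linarith))
    refine Asymptotics.IsBigO.trans_isLittleO (Asymptotics.IsBigO.of_bound K ?_) hy
    filter_upwards [hnear] with τ hτ
    simpa only [dist_eq_norm] using
      hK.dist_le_mul (y τ) hτ (y t) ⟨by linarith, by linarith⟩

lemma AbsolutelyContinuousOnInterval.lipschitzOnWith_comp {G y : ℝ → ℝ} {a b : ℝ} {S : Set ℝ}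
    {K : NNReal} (hy : AbsolutelyContinuousOnInterval y a b) (hG : LipschitzOnWith K G S)
    (hS : MapsTo y (uIcc a b) S) : AbsolutelyContinuousOnInterval (fun t => G (y t)) a b := by
  have hK := Tendsto.const_mul (K : ℝ) hy
  rw [mul_zero] at hK
  refine squeeze_zero' (Eventually.of_forall fun E => Finset.sum_nonneg fun _ _ => dist_nonneg)
    ?_ hK
  refine eventually_inf_principal.2 (Eventually.of_forall fun E hE => ?_)
  rw [Finset.mul_sum]
  exact Finset.sum_le_sum fun i hi =>
    hG.dist_le_mul _ (hS (hE.1 i hi).1) _ (hS (hE.1 i hi).2)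

lemma AbsolutelyContinuousOnInterval.const (c a b : ℝ) :
    AbsolutelyContinuousOnInterval (fun _ => c) a b :=
  ((LipschitzWith.const c).lipschitzOnWith (s := uIcc a b)).absolutelyContinuousOnInterval

lemma AbsolutelyContinuousOnInterval.finset_sum {ι : Type*} (s : Finset ι) {F : ι → ℝ → ℝ}
    {a b : ℝ} (hF : ∀ i ∈ s, AbsolutelyContinuousOnInterval (F i) a b) :
    AbsolutelyContinuousOnInterval (fun t => ∑ i ∈ s, F i t) a b := by
  induction s using Finset.cons_induction with
  | empty => simpa using AbsolutelyContinuousOnInterval.const 0 a b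
  | cons i s hi ih =>
    simp only [Finset.sum_cons]
    exact (hF i (by simp)).fun_add (ih fun j hj => hF j (by simp [hj]))

lemma AbsolutelyContinuousOnInterval.sub_le_of_ae_deriv_le {f : ℝ → ℝ} {a b k : ℝ} (hab : a ≤ b)
    (hf : AbsolutelyContinuousOnInterval f a b)
    (hk : ∀ᵐ t, t ∈ Set.Ioo a b → deriv f t ≤ k) : f b - f a ≤ k * (b - a) := by
  rw [← hf.integral_deriv_eq_sub]
  calc ∫ t in a..b, deriv f t ≤ ∫ _ in a..b, k := by
        refine intervalIntegral.integral_mono_ae_restrict hab hf.intervalIntegrable_deriv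
          intervalIntegrable_const ?_
        rw [← Measure.restrict_congr_set Ioo_ae_eq_Icc]
        exact (ae_restrict_iff' measurableSet_Ioo).2 hk
    _ = k * (b - a) := by simp [mul_comm]

/-- Lyapunov function of Lur'e-Postnikov type. -/
def lurePostnikov {n p : ℕ} (P : Matrix (Fin n) (Fin n) ℝ) (C : Matrix (Fin p) (Fin n) ℝ)
    (ψ : Fin p → ℝ → ℝ) (γ : Fin p → ℝ) (x : Fin n → ℝ) : ℝ :=
  x ⬝ᵥ P *ᵥ x + 2 * ∑ i, γ i * ∫ s in (0 : ℝ)..(C *ᵥ x) i, ψ i s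

/-- The linear matrix inequality bounds the derivative of the Lyapunov function. -/
lemma lure_deriv_le {n p : ℕ} {A : Matrix (Fin n) (Fin n) ℝ} {B : Matrix (Fin n) (Fin p) ℝ}
    {C : Matrix (Fin p) (Fin n) ℝ} {z γ h : Fin p → ℝ} {P : Matrix (Fin n) (Fin n) ℝ} {η : ℝ}
    (hM : ∀ v : Fin n ⊕ Fin p → ℝ,
      v ⬝ᵥ (Matrix.fromBlocks
        (P * A + Aᵀ * P + η • (1 : Matrix (Fin n) (Fin n) ℝ))
        (P * B)
        (Bᵀ * P)
        ((-2 : ℝ) • Matrix.diagonal z - Matrix.diagonal γ * C * B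
          - (Matrix.diagonal γ * C * B)ᵀ)).mulVec v ≤ 0)
    (hH : Matrix.diagonal γ * C * A = Matrix.diagonal h * C)
    (x : Fin n → ℝ) (u : Fin p → ℝ)
    (hu : ∀ i, z i * u i ^ 2 ≤ h i * ((C *ᵥ x) i * u i)) :
    (A *ᵥ x + B *ᵥ u) ⬝ᵥ P *ᵥ x + x ⬝ᵥ P *ᵥ (A *ᵥ x + B *ᵥ u)
      + 2 * ∑ i, γ i * (-u i * (C *ᵥ (A *ᵥ x + B *ᵥ u)) i) ≤ -(η * ∑ i, x i ^ 2) := by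
  have hv := hM (Sum.elim x u)
  have e₁ : x ⬝ᵥ (P * A) *ᵥ x = x ⬝ᵥ P *ᵥ (A *ᵥ x) := by rw [mulVec_mulVec]
  have e₂ : x ⬝ᵥ (Aᵀ * P) *ᵥ x = (A *ᵥ x) ⬝ᵥ P *ᵥ x := by
    rw [← mulVec_mulVec, dotProduct_mulVec, vecMul_transpose]
  have e₃ : x ⬝ᵥ (P * B) *ᵥ u = x ⬝ᵥ P *ᵥ (B *ᵥ u) := by rw [mulVec_mulVec]
  have e₄ : u ⬝ᵥ (Bᵀ * P) *ᵥ x = (B *ᵥ u) ⬝ᵥ P *ᵥ x := by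
    rw [← mulVec_mulVec, dotProduct_mulVec, vecMul_transpose]
  have e₅ : u ⬝ᵥ Matrix.diagonal z *ᵥ u = ∑ i, z i * u i ^ 2 := by
    simp only [dotProduct, mulVec_diagonal]
    exact Finset.sum_congr rfl fun i _ => by ring
  have e₆ : u ⬝ᵥ (Matrix.diagonal γ * C * B) *ᵥ u = ∑ i, γ i * (u i * (C *ᵥ (B *ᵥ u)) i) := by
    rw [← mulVec_mulVec, ← mulVec_mulVec]
    simp only [dotProduct, mulVec_diagonal]
    exact Finset.sum_congr rfl fun i _ => by ring
  have e₇ : u ⬝ᵥ (Matrix.diagonal γ * C * B)ᵀ *ᵥ u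
      = ∑ i, γ i * (u i * (C *ᵥ (B *ᵥ u)) i) := by
    rw [dotProduct_mulVec, vecMul_transpose, dotProduct_comm, e₆]
  have e₈ : ∑ i, γ i * (u i * (C *ᵥ (A *ᵥ x)) i) = ∑ i, h i * ((C *ᵥ x) i * u i) := by
    have hHx := congrArg (fun M => u ⬝ᵥ M *ᵥ x) hH
    simp only [← mulVec_mulVec] at hHx
    simp only [dotProduct, mulVec_diagonal] at hHx
    convert hHx using 2 <;> ring
  have e₉ : x ⬝ᵥ x = ∑ i, x i ^ 2 := by simp only [dotProduct, sq]
  have hsum := Finset.sum_le_sum fun i (_ : i ∈ Finset.univ) => hu i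
  have hexp : ∑ i, γ i * (-u i * (C *ᵥ (A *ᵥ x + B *ᵥ u)) i)
      = -∑ i, γ i * (u i * (C *ᵥ (A *ᵥ x)) i) - ∑ i, γ i * (u i * (C *ᵥ (B *ᵥ u)) i) := by
    rw [← Finset.sum_neg_distrib, ← Finset.sum_sub_distrib]
    refine Finset.sum_congr rfl fun i _ => ?_
    rw [mulVec_add, Pi.add_apply]
    ring
  rw [Matrix.fromBlocks_mulVec, sumElim_dotProduct_sumElim] at hv
  simp only [Sum.elim_comp_inl, Sum.elim_comp_inr, Matrix.add_mulVec, Matrix.sub_mulVec,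
    Matrix.smul_mulVec, Matrix.one_mulVec, dotProduct_add, dotProduct_sub, dotProduct_smul,
    smul_eq_mul, e₁, e₂, e₃, e₄, e₅, e₆, e₇, e₉] at hv
  rw [hexp, e₈]
  simp only [mulVec_add, dotProduct_add, add_dotProduct]
  linarith

lemma exists_dotProduct_mulVec_le {n : ℕ} (P : Matrix (Fin n) (Fin n) ℝ) :
    ∃ c, 0 ≤ c ∧ ∀ x, x ⬝ᵥ P *ᵥ x ≤ c * ∑ i, x i ^ 2 := by
  refine ⟨∑ i, ∑ j, |P i j|, by positivity, fun x => ?_⟩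
  have hle : ∀ i, x i ^ 2 ≤ ∑ k, x k ^ 2 := fun i =>
    Finset.single_le_sum (f := fun k => x k ^ 2) (fun k _ => sq_nonneg _) (Finset.mem_univ i)
  simp only [dotProduct, mulVec, Finset.mul_sum (s := Finset.univ) (f := fun j => P _ j * x j)]
  rw [Finset.sum_mul]
  refine Finset.sum_le_sum fun i _ => ?_
  rw [Finset.sum_mul]
  refine Finset.sum_le_sum fun j _ => ?_
  calc x i * (P i j * x j) = P i j * (x i * x j) := by ring
    _ ≤ |P i j| * |x i * x j| := (le_abs_self _).trans (abs_mul _ _).le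
    _ ≤ |P i j| * ∑ k, x k ^ 2 := by
        gcongr
        rw [abs_le]
        constructor <;> nlinarith [hle i, hle j, sq_nonneg (x i + x j), sq_nonneg (x i - x j)]

lemma exists_mul_le_dotProduct_mulVec {n : ℕ} {P : Matrix (Fin n) (Fin n) ℝ} (hP : P.PosDef) :
    ∃ c, 0 < c ∧ ∀ x, c * ∑ i, x i ^ 2 ≤ x ⬝ᵥ P *ᵥ x := by
  have hpos : ∀ x ≠ 0, 0 < x ⬝ᵥ P *ᵥ x := fun x hx => by simpa using hP.dotProduct_mulVec_pos hx
  have hcont : Continuous fun x : Fin n → ℝ => x ⬝ᵥ P *ᵥ x :=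
    continuous_id.dotProduct (Continuous.matrix_mulVec continuous_const continuous_id)
  have hcompact : IsCompact {x : Fin n → ℝ | ∑ i, x i ^ 2 = 1} := by
    refine Metric.isCompact_of_isClosed_isBounded
      (isClosed_eq (by fun_prop) continuous_const) ?_
    refine (Metric.isBounded_closedBall (x := 0) (r := 1)).subset fun x hx => ?_
    rw [mem_closedBall_zero_iff, pi_norm_le_iff_of_nonneg zero_le_one]
    intro i
    rw [Real.norm_eq_abs, ← sq_le_one_iff_abs_le_one, ← (show ∑ i, x i ^ 2 = 1 from hx)]
    exact Finset.single_le_sum (f := fun k => x k ^ 2) (fun k _ => sq_nonneg _)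
      (Finset.mem_univ i)
  obtain ⟨c, hc, hcS⟩ : ∃ c, 0 < c ∧ ∀ x : Fin n → ℝ, ∑ i, x i ^ 2 = 1 → c ≤ x ⬝ᵥ P *ᵥ x := by
    rcases {x : Fin n → ℝ | ∑ i, x i ^ 2 = 1}.eq_empty_or_nonempty with h | h
    · exact ⟨1, one_pos, fun x hx => (h.subset hx).elim⟩
    · obtain ⟨x, hx, hmin⟩ := hcompact.exists_isMinOn h hcont.continuousOn
      refine ⟨_, hpos x ?_, fun y hy => hmin hy⟩
      rintro rfl
      simp at hx
  refine ⟨c, hc, fun x => ?_⟩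
  have h0 : 0 ≤ ∑ i, x i ^ 2 := by positivity
  rcases h0.eq_or_lt with h | h
  · rw [← h, mul_zero]
    by_cases hx : x = 0
    · simp [hx]
    · exact (hpos x hx).le
  · set r := Real.sqrt (∑ i, x i ^ 2) with hr
    have hr0 : 0 < r := Real.sqrt_pos.2 h
    have hr2 : r ^ 2 = ∑ i, x i ^ 2 := Real.sq_sqrt h0
    have := hcS (r⁻¹ • x) (by
      simp only [Pi.smul_apply, smul_eq_mul, mul_pow, ← Finset.mul_sum, ← hr2]
      field_simp)
    rw [mulVec_smul, dotProduct_smul, smul_dotProduct, smul_eq_mul, smul_eq_mul] at this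
    calc c * ∑ i, x i ^ 2 = c * r ^ 2 := by rw [hr2]
      _ ≤ (r⁻¹ * (r⁻¹ * (x ⬝ᵥ P *ᵥ x))) * r ^ 2 := by gcongr
      _ = x ⬝ᵥ P *ᵥ x := by field_simp

lemma euclNorm_nonneg {m : ℕ} (x : Fin m → ℝ) : 0 ≤ euclNorm x := Real.sqrt_nonneg _

lemma sq_euclNorm {m : ℕ} (x : Fin m → ℝ) : euclNorm x ^ 2 = ∑ i, x i ^ 2 :=
  Real.sq_sqrt (by positivity)

lemma abs_le_euclNorm {m : ℕ} (x : Fin m → ℝ) (i : Fin m) : |x i| ≤ euclNorm x := by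
  refine Real.abs_le_sqrt ?_
  exact Finset.single_le_sum (f := fun k => x k ^ 2) (fun k _ => sq_nonneg _) (Finset.mem_univ i)

lemma continuous_euclNorm {m : ℕ} : Continuous (euclNorm : (Fin m → ℝ) → ℝ) := by
  unfold euclNorm
  fun_prop

lemma abs_mulVec_le {n p : ℕ} (C : Matrix (Fin p) (Fin n) ℝ) (x : Fin n → ℝ) (i : Fin p) :
    |(C *ᵥ x) i| ≤ (∑ j, |C i j|) * euclNorm x := by
  rw [mulVec, dotProduct, Finset.sum_mul]
  refine (Finset.abs_sum_le_sum_abs _ _).trans (Finset.sum_le_sum fun j _ => ?_)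
  rw [abs_mul]
  gcongr
  exact abs_le_euclNorm x j

/-- The Lyapunov function is dominated by a class `K∞` function of the norm. -/
lemma exists_lurePostnikov_le {n p : ℕ} (P : Matrix (Fin n) (Fin n) ℝ)
    (C : Matrix (Fin p) (Fin n) ℝ) {ψ : Fin p → ℝ → ℝ} {z γ : Fin p → ℝ}
    (hψ : ∀ i, PiecewiseContinuous (ψ i)) (hs : ∀ i, Sector (ψ i) (z i)) (hγ : ∀ i, 0 < γ i) :
    ∃ α, ClassKInf α ∧ ∀ x, lurePostnikov P C ψ γ x ≤ α (euclNorm x) := by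
  obtain ⟨c, hc, hcP⟩ := exists_dotProduct_mulVec_le P
  set G : Fin p → ℝ → ℝ := fun i y => ∫ s in (0 : ℝ)..y, ψ i s with hG
  set K : Fin p → ℝ := fun i => ∑ j, |C i j| with hK
  have hK0 : ∀ i, 0 ≤ K i := fun i => Finset.sum_nonneg fun j _ => abs_nonneg _
  have hGc : ∀ i, Continuous (G i) := fun i => (hψ i).continuous_integral
  have hG0 : ∀ i y, 0 ≤ G i y := fun i => (hs i).integral_nonneg (hψ i)
  have hmono : ∀ i, MonotoneOn (G i) (Set.Ici 0) := fun i => (hs i).monotoneOn_integral (hψ i)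
  have hanti : ∀ i, AntitoneOn (G i) (Set.Iic 0) := fun i => (hs i).antitoneOn_integral (hψ i)
  have hle : ∀ r, 0 ≤ r → r ≤ c * r ^ 2 + r + 2 * ∑ i, γ i * (G i (K i * r) + G i (-(K i * r))) := by
    intro r hr
    have : 0 ≤ ∑ i, γ i * (G i (K i * r) + G i (-(K i * r))) :=
      Finset.sum_nonneg fun i _ => mul_nonneg (hγ i).le (add_nonneg (hG0 _ _) (hG0 _ _))
    nlinarith [sq_nonneg r]
  refine ⟨fun r => c * r ^ 2 + r + 2 * ∑ i, γ i * (G i (K i * r) + G i (-(K i * r))),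
    ⟨?_, ?_, ?_, ?_⟩, ?_⟩
  · refine Continuous.continuousOn ?_
    fun_prop
  · intro r hr t ht hrt
    have hr' : 0 ≤ r := hr
    have hsum : ∑ i, γ i * (G i (K i * r) + G i (-(K i * r)))
        ≤ ∑ i, γ i * (G i (K i * t) + G i (-(K i * t))) := by
      refine Finset.sum_le_sum fun i _ => mul_le_mul_of_nonneg_left (add_le_add ?_ ?_) (hγ i).le
      · exact hmono i (mul_nonneg (hK0 i) hr) (mul_nonneg (hK0 i) ht)
          (mul_le_mul_of_nonneg_left hrt.le (hK0 i))
      · exact hanti i (neg_nonpos.2 (mul_nonneg (hK0 i) ht))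
          (neg_nonpos.2 (mul_nonneg (hK0 i) hr))
          (neg_le_neg (mul_le_mul_of_nonneg_left hrt.le (hK0 i)))
    have : c * r ^ 2 ≤ c * t ^ 2 := by gcongr
    simp only
    linarith
  · simp [hG]
  · exact tendsto_atTop_mono' _ ((eventually_ge_atTop 0).mono hle) tendsto_id
  · intro x
    have hsum : ∑ i, γ i * G i ((C *ᵥ x) i) ≤
        ∑ i, γ i * (G i (K i * euclNorm x) + G i (-(K i * euclNorm x))) := by
      refine Finset.sum_le_sum fun i _ => mul_le_mul_of_nonneg_left ?_ (hγ i).le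
      have hb := abs_le.1 (abs_mulVec_le C x i)
      have hKx : 0 ≤ K i * euclNorm x := mul_nonneg (hK0 i) (euclNorm_nonneg x)
      rcases le_total 0 ((C *ᵥ x) i) with h | h
      · exact (hmono i h hKx hb.2).trans (le_add_of_nonneg_right (hG0 _ _))
      · exact (hanti i (neg_nonpos.2 hKx) h hb.1).trans (le_add_of_nonneg_left (hG0 _ _))
    have := hcP x
    rw [← sq_euclNorm] at this
    have := euclNorm_nonneg x
    unfold lurePostnikov
    simp only [hG] at hsum ⊢
    linarith

/-- A class `KL` function built from a class `K∞` function. -/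
lemma ClassKInf.classKL {α : ℝ → ℝ} (hα : ClassKInf α) {c η : ℝ} (hc : 0 < c) (hη : 0 < η) :
    ClassKL fun s t => Real.sqrt (α (Real.sqrt ((s ^ 2 + α s) / (1 + η * t))) / c) := by
  obtain ⟨hcont, hmono, h0, -⟩ := hα
  have hα0 : ∀ s, 0 ≤ s → 0 ≤ α s := fun s hs => by
    rw [← h0]
    exact hmono.monotoneOn (mem_Ici.2 le_rfl) hs hs
  have hsqrt : ∀ s, Real.sqrt s ∈ Set.Ici (0 : ℝ) := fun s => Real.sqrt_nonneg s
  refine ⟨fun t ht => ?_, fun s hs => ?_⟩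
  · have hden : 0 < 1 + η * t := by positivity
    refine ⟨?_, ?_, by simp [h0]⟩
    · refine ContinuousOn.sqrt (ContinuousOn.div_const (hcont.comp ?_ fun s _ => hsqrt _) c)
      exact (((continuousOn_id.pow 2).add hcont).div_const _).sqrt
    · intro r hr s hs hrs
      have hr' : 0 ≤ r := hr
      have := hmono hr hs hrs
      have hlt : Real.sqrt ((r ^ 2 + α r) / (1 + η * t))
          < Real.sqrt ((s ^ 2 + α s) / (1 + η * t)) := by
        refine Real.sqrt_lt_sqrt (div_nonneg (add_nonneg (sq_nonneg _) (hα0 r hr)) hden.le) ?_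
        gcongr
      refine Real.sqrt_lt_sqrt (div_nonneg (hα0 _ (hsqrt _)) hc.le) ?_
      exact div_lt_div_of_pos_right (hmono (hsqrt _) (hsqrt _) hlt) hc
  · have hnum : 0 ≤ s ^ 2 + α s := add_nonneg (sq_nonneg _) (hα0 s hs)
    refine ⟨fun t ht r _ htr => ?_, ?_⟩
    · have ht' : 0 ≤ t := ht
      refine Real.sqrt_le_sqrt (div_le_div_of_nonneg_right ?_ hc.le)
      refine hmono.monotoneOn (hsqrt _) (hsqrt _) (Real.sqrt_le_sqrt ?_)
      gcongr
    · have h1 : Tendsto (fun t => (s ^ 2 + α s) / (1 + η * t)) atTop (𝓝 0) :=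
        tendsto_const_nhds.div_atTop
          (tendsto_atTop_add_const_left _ _ (tendsto_id.const_mul_atTop hη))
      have h2 := h1.sqrt
      rw [Real.sqrt_zero] at h2
      have h3 : Tendsto (fun t => α (Real.sqrt ((s ^ 2 + α s) / (1 + η * t)))) atTop (𝓝 0) := by
        have := hcont 0 (mem_Ici.2 le_rfl)
        rw [ContinuousWithinAt, h0] at this
        exact this.comp (tendsto_nhdsWithin_iff.2 ⟨h2, Eventually.of_forall fun t => hsqrt _⟩)
      simpa using (h3.div_const c).sqrt

lemma absolutelyContinuousOnInterval_mulVec {m n : ℕ} (M : Matrix (Fin m) (Fin n) ℝ)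
    {X : ℝ → Fin n → ℝ} {a b : ℝ}
    (hX : ∀ j, AbsolutelyContinuousOnInterval (fun t => X t j) a b) (i : Fin m) :
    AbsolutelyContinuousOnInterval (fun t => (M *ᵥ X t) i) a b :=
  AbsolutelyContinuousOnInterval.finset_sum (F := fun j t => M i j * X t j) Finset.univ
    fun j _ => (hX j).const_mul (M i j)

lemma absolutelyContinuousOnInterval_lurePostnikov {n p : ℕ} (P : Matrix (Fin n) (Fin n) ℝ)
    (C : Matrix (Fin p) (Fin n) ℝ) {ψ : Fin p → ℝ → ℝ} (γ : Fin p → ℝ)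
    (hψ : ∀ i, PiecewiseContinuous (ψ i)) {X : ℝ → Fin n → ℝ} {a b : ℝ}
    (hX : ∀ j, AbsolutelyContinuousOnInterval (fun t => X t j) a b) :
    AbsolutelyContinuousOnInterval (fun t => lurePostnikov P C ψ γ (X t)) a b := by
  refine .fun_add ?_ (.const_mul 2 (.finset_sum Finset.univ fun i _ => .const_mul (γ i) ?_))
  · exact .finset_sum (F := fun i t => X t i * (P *ᵥ X t) i) Finset.univ
      fun i _ => (hX i).fun_mul (absolutelyContinuousOnInterval_mulVec P hX i)
  · have hy := absolutelyContinuousOnInterval_mulVec C hX i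
    obtain ⟨M, hM⟩ := hy.exists_bound
    obtain ⟨K, hK⟩ := (hψ i).lipschitzOnWith_integral (-M) M
    have hmaps : MapsTo (fun t => (C *ᵥ X t) i) (uIcc a b) (Set.Icc (-M) M) := fun t ht => by
      have := hM t ht
      rw [Real.norm_eq_abs] at this
      exact abs_le.1 this
    exact hy.lipschitzOnWith_comp (G := fun y => ∫ s in (0 : ℝ)..y, ψ i s) hK hmaps

lemma hasDerivAt_mulVec {m n : ℕ} (M : Matrix (Fin m) (Fin n) ℝ) {X : ℝ → Fin n → ℝ}
    {v : Fin n → ℝ} {t : ℝ} (hX : ∀ j, HasDerivAt (fun τ => X τ j) (v j) t) (i : Fin m) :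
    HasDerivAt (fun τ => (M *ᵥ X τ) i) ((M *ᵥ v) i) t :=
  HasDerivAt.fun_sum (u := Finset.univ) (A := fun j τ => M i j * X τ j)
    (A' := fun j => M i j * v j) fun j _ => (hX j).const_mul (M i j)

lemma hasDerivAt_lurePostnikov {n p : ℕ} (P : Matrix (Fin n) (Fin n) ℝ)
    (C : Matrix (Fin p) (Fin n) ℝ) {ψ : Fin p → ℝ → ℝ} (γ : Fin p → ℝ)
    (hψ : ∀ i, PiecewiseContinuous (ψ i)) {X : ℝ → Fin n → ℝ} {v : Fin n → ℝ} {w : Fin p → ℝ}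
    {t : ℝ} (hX : ∀ j, HasDerivAt (fun τ => X τ j) (v j) t) (hw : w ∈ PsiSet ψ (C *ᵥ X t))
    (hc : ∀ i, ¬ ContinuousAt (ψ i) ((C *ᵥ X t) i) → (C *ᵥ v) i = 0) :
    HasDerivAt (fun τ => lurePostnikov P C ψ γ (X τ))
      (v ⬝ᵥ P *ᵥ X t + X t ⬝ᵥ P *ᵥ v + 2 * ∑ i, γ i * (w i * (C *ᵥ v) i)) t := by
  refine .fun_add ?_ (.const_mul 2 (.fun_sum fun i _ => .const_mul (γ i)
    ((hψ i).hasDerivAt_integral_comp (hasDerivAt_mulVec C hX i) (hw i) (hc i))))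
  simp only [dotProduct, ← Finset.sum_add_distrib]
  exact .fun_sum fun i _ => (hX i).mul (hasDerivAt_mulVec P hX i)

/-- Dissipation inequality along Krasovskii solutions. -/
lemma IsKrasovskiiSolutionOn.lurePostnikov_add_le {n p : ℕ} {A : Matrix (Fin n) (Fin n) ℝ}
    {B : Matrix (Fin n) (Fin p) ℝ} {C : Matrix (Fin p) (Fin n) ℝ} {ψ : Fin p → ℝ → ℝ}
    {γ : Fin p → ℝ} {P : Matrix (Fin n) (Fin n) ℝ} {η : ℝ} (hη : 0 ≤ η)
    (hψ : ∀ i, PiecewiseContinuous (ψ i))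
    (hdiss : ∀ (x : Fin n → ℝ) (u : Fin p → ℝ), (fun i => -u i) ∈ PsiSet ψ (C *ᵥ x) →
      (A *ᵥ x + B *ᵥ u) ⬝ᵥ P *ᵥ x + x ⬝ᵥ P *ᵥ (A *ᵥ x + B *ᵥ u)
        + 2 * ∑ i, γ i * (-u i * (C *ᵥ (A *ᵥ x + B *ᵥ u)) i) ≤ -(η * ∑ i, x i ^ 2))
    {T : ℝ≥0∞} {x : ℝ → Fin n → ℝ} (hx : IsKrasovskiiSolutionOn (lureF A B C ψ) x (timeItv T))
    {a b k : ℝ} (ha : 0 ≤ a) (hab : a ≤ b) (hb : b ∈ timeItv T)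
    (hk : ∀ t ∈ Set.Icc a b, k ≤ ∑ i, x t i ^ 2) :
    lurePostnikov P C ψ γ (x b) + η * k * (b - a) ≤ lurePostnikov P C ψ γ (x a) := by
  obtain ⟨f, hint, hF, hxf⟩ := hx
  have hmem : ∀ t ∈ Set.Icc 0 b, t ∈ timeItv T := fun t ht =>
    ⟨ht.1, (ENNReal.ofReal_le_ofReal ht.2).trans_lt hb.2⟩
  have hintj : ∀ t ∈ Set.Icc 0 b, ∀ j, IntervalIntegrable (fun s => f s j) volume 0 t :=
    fun t ht j =>
      let π := ContinuousLinearMap.proj (R := ℝ) (φ := fun _ : Fin n => ℝ) j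
      ⟨π.integrable_comp (hint t (hmem t ht)).1, π.integrable_comp (hint t (hmem t ht)).2⟩
  have hb0 : 0 ≤ b := ha.trans hab
  have hbb : b ∈ Set.Icc 0 b := ⟨hb0, le_rfl⟩
  set X : ℝ → Fin n → ℝ := fun t j => x 0 j + ∫ s in (0 : ℝ)..t, f s j with hX
  have hxX : ∀ t ∈ Set.Icc 0 b, x t = X t := by
    intro t ht
    ext j
    rw [hxf t (hmem t ht), Pi.add_apply, hX]
    simp only [add_right_inj]
    exact ((ContinuousLinearMap.proj (R := ℝ) (φ := fun _ : Fin n => ℝ) j)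
      |>.intervalIntegral_comp_comm (hint t (hmem t ht))).symm
  have hsub : Set.Icc a b ⊆ Set.Icc 0 b := Set.Icc_subset_Icc_left ha
  have hac : ∀ j, AbsolutelyContinuousOnInterval (fun t => X t j) a b := by
    intro j
    refine ((AbsolutelyContinuousOnInterval.const (x 0 j) 0 b).fun_add
      ((hintj b hbb j).absolutelyContinuousOnInterval_intervalIntegral left_mem_uIcc)).mono ?_
    rwa [uIcc_of_le hab, uIcc_of_le hb0]
  have hderiv : ∀ᵐ t, t ∈ Set.Icc 0 b → ∀ j, HasDerivAt (fun τ => X τ j) (f t j) t := by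
    have := ae_all_iff.2 fun j => (hintj b hbb j).ae_hasDerivAt_integral
    filter_upwards [this] with t ht htb j
    rw [← uIcc_of_le hb0] at htb
    exact (ht j htb 0 left_mem_uIcc).const_add (x 0 j)
  have hlevel := ae_all_iff.2 fun i => ae_deriv_eq_zero_of_mem_countable
    (fun t => (C *ᵥ X t) i) (hψ i).countable_discontinuities
  have hVac := absolutelyContinuousOnInterval_lurePostnikov P C γ hψ hac
  have hle := hVac.sub_le_of_ae_deriv_le (k := -(η * k)) hab (by
    filter_upwards [hderiv, hlevel, hF] with t hdt hlt hFt ht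
    have ht' := hsub (Ioo_subset_Icc_self ht)
    have hd := hdt ht'
    obtain ⟨u, hu, hfu⟩ := hFt (hmem t ht')
    have hkt := hk t (Ioo_subset_Icc_self ht)
    rw [hxX t ht'] at hu hfu hkt
    have hV := hasDerivAt_lurePostnikov P C γ hψ hd hu fun i hi =>
      hlt i hi _ (hasDerivAt_mulVec C hd i)
    rw [hV.deriv, hfu]
    exact (hdiss _ _ hu).trans (neg_le_neg (mul_le_mul_of_nonneg_left hkt hη)))
  rw [hxX b hbb, hxX a ⟨ha, hab⟩]
  linarith

/-- Krasovskii solutions are continuous. -/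
lemma IsKrasovskiiSolutionOn.continuousOn {n : ℕ} {F : (Fin n → ℝ) → Set (Fin n → ℝ)}
    {x : ℝ → Fin n → ℝ} {T : ℝ≥0∞} (hx : IsKrasovskiiSolutionOn F x (timeItv T)) {b : ℝ}
    (hb : b ∈ timeItv T) : ContinuousOn x (Set.Icc 0 b) := by
  obtain ⟨f, hint, -, hxf⟩ := hx
  have hcont : ContinuousOn (fun t => x 0 + ∫ s in (0 : ℝ)..t, f s) (Set.Icc 0 b) := by
    refine continuousOn_const.add ?_
    rw [← uIcc_of_le hb.1]
    exact intervalIntegral.continuousOn_primitive_interval' (hint b hb) left_mem_uIcc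
  exact hcont.congr fun t ht => hxf t ⟨ht.1, (ENNReal.ofReal_le_ofReal ht.2).trans_lt hb.2⟩

/-- under Assumption 1, the alternative LMI (ii) and the
structural condition (iii) (`ΓCA = HC` with suitable diagonal `H`), the origin
of the regularized Lur'e system is GAS. -/
theorem stmt5 {n p : ℕ} (A : Matrix (Fin n) (Fin n) ℝ) (B : Matrix (Fin n) (Fin p) ℝ)
    (C : Matrix (Fin p) (Fin n) ℝ) (ψ : Fin p → ℝ → ℝ) (z : Fin p → ℝ)
    (γ : Fin p → ℝ) (P : Matrix (Fin n) (Fin n) ℝ) (η : ℝ) (h : Fin p → ℝ)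
    -- Assumption 1
    (hA1 : ∀ i, PiecewiseContinuous (ψ i) ∧ Sector (ψ i) (z i))
    -- item (ii): alternative LMI
    (hγ : ∀ i, 0 < γ i) (hPsym : P.IsSymm) (hPpos : P.PosDef) (hη : 0 < η)
    (hM : ∀ v : Fin n ⊕ Fin p → ℝ,
      v ⬝ᵥ (Matrix.fromBlocks
        (P * A + Aᵀ * P + η • (1 : Matrix (Fin n) (Fin n) ℝ))
        (P * B)
        (Bᵀ * P)
        ((-2 : ℝ) • Matrix.diagonal z - Matrix.diagonal γ * C * B
          - (Matrix.diagonal γ * C * B)ᵀ)).mulVec v ≤ 0)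
    -- item (iii): ΓCA = HC with H diagonal
    (hH : Matrix.diagonal γ * C * A = Matrix.diagonal h * C)
    (hHi : ∀ i, h i ≤ -1 ∨ (h i ≤ 0 ∧ ∀ j, z j = 0)) :
    ∃ β : ℝ → ℝ → ℝ, ClassKL β ∧
      ∀ T : ℝ≥0∞, ∀ x : ℝ → Fin n → ℝ,
        IsKrasovskiiSolutionOn (lureF A B C ψ) x (timeItv T) →
        ∀ t ∈ timeItv T, euclNorm (x t) ≤ β (euclNorm (x 0)) t := by
  have hψ : ∀ i, PiecewiseContinuous (ψ i) := fun i => (hA1 i).1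
  have hs : ∀ i, Sector (ψ i) (z i) := fun i => (hA1 i).2
  obtain ⟨α, hα, hVα⟩ := exists_lurePostnikov_le P C hψ hs hγ
  obtain ⟨c, hc, hcP⟩ := exists_mul_le_dotProduct_mulVec hPpos
  have hcV : ∀ x, c * euclNorm x ^ 2 ≤ lurePostnikov P C ψ γ x := by
    intro x
    rw [sq_euclNorm]
    refine (hcP x).trans (le_add_of_nonneg_right (mul_nonneg zero_le_two ?_))
    exact Finset.sum_nonneg fun i _ => mul_nonneg (hγ i).le ((hs i).integral_nonneg (hψ i) _)
  have hdiss : ∀ (x : Fin n → ℝ) (u : Fin p → ℝ), (fun i => -u i) ∈ PsiSet ψ (C *ᵥ x) →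
      (A *ᵥ x + B *ᵥ u) ⬝ᵥ P *ᵥ x + x ⬝ᵥ P *ᵥ (A *ᵥ x + B *ᵥ u)
        + 2 * ∑ i, γ i * (-u i * (C *ᵥ (A *ᵥ x + B *ᵥ u)) i) ≤ -(η * ∑ i, x i ^ 2) := by
    intro x u hu
    refine lure_deriv_le hM hH x u fun i => ?_
    have hsign := (hs i).mul_nonneg_of_mem_kras (hu i)
    have hsec := (hs i).mul_sq_le_of_mem_kras (hu i)
    rcases hHi i with hi | ⟨hi, hz⟩
    · nlinarith
    · rw [hz i]
      nlinarith
  refine ⟨_, hα.classKL hc hη, fun T x hx t ht => ?_⟩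
  obtain ⟨s, hs_mem, hmin⟩ := isCompact_Icc.exists_isMinOn (nonempty_Icc.2 ht.1)
    (continuous_euclNorm.comp_continuousOn (hx.continuousOn ht))
  have hmin' : ∀ τ ∈ Set.Icc 0 t, euclNorm (x s) ≤ euclNorm (x τ) := fun τ hτ => hmin hτ
  have hk : ∀ τ ∈ Set.Icc 0 t, euclNorm (x s) ^ 2 ≤ ∑ i, x τ i ^ 2 := fun τ hτ => by
    rw [← sq_euclNorm]
    exact pow_le_pow_left₀ (euclNorm_nonneg _) (hmin' τ hτ) 2
  have hdecay := hx.lurePostnikov_add_le hη.le hψ hdiss le_rfl ht.1 ht hk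
  have hmono := hx.lurePostnikov_add_le hη.le hψ hdiss (k := 0) hs_mem.1 hs_mem.2 ht
    fun τ _ => by positivity
  have hden : 0 < 1 + η * t := by
    have := ht.1
    positivity
  have hxs : euclNorm (x s) ≤
      Real.sqrt ((euclNorm (x 0) ^ 2 + α (euclNorm (x 0))) / (1 + η * t)) := by
    refine Real.le_sqrt_of_sq_le ((le_div_iff₀ hden).2 ?_)
    have h0 := pow_le_pow_left₀ (euclNorm_nonneg _) (hmin' 0 ⟨le_rfl, ht.1⟩) 2
    have hVt : 0 ≤ lurePostnikov P C ψ γ (x t) := (by positivity : 0 ≤ c * _).trans (hcV (x t))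
    linarith [hVα (x 0)]
  refine Real.le_sqrt_of_sq_le ((le_div_iff₀ hc).2 ?_)
  have hαs := hα.2.1.monotoneOn (euclNorm_nonneg (x s)) (Real.sqrt_nonneg _) hxs
  linarith [hcV (x t), hVα (x s)]
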